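/- Let h_1,…,h_n ∈ ℤ_{≥0} with H = h_1+⋯+h_n, and set d = max_{1≤i≤n}(h_i+1)(H−h_i) + 1. Then (y_1^{(h_1)}·y_2^{(h_2)}⋯y_n^{(h_n)})^d ∈ I_H. -/

import Mathlib

open MvPolynomial

section JetIdeal

variable (ι k : Type*) [CommRing k]

variable {ι} in
/-- The generic power series `∑ⱼ X (i, j) tʲ`. -/
noncomputable def jetSeries (i : ι) : PowerSeries (MvPolynomial (ι × ℕ) k) :=
  PowerSeries.mk fun j => X (i, j)

/-- The coefficient of `t ^ m` in the product of the generic power series. -/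
noncomputable def jetCoeff [Fintype ι] (m : ℕ) : MvPolynomial (ι × ℕ) k :=
  PowerSeries.coeff m (∏ i : ι, jetSeries k i)

/-- The ideal generated by the first `N` coefficients of the product of the generic series. -/
noncomputable def jetIdeal [Fintype ι] (N : ℕ) : Ideal (MvPolynomial (ι × ℕ) k) :=
  Ideal.span (jetCoeff ι k '' Set.Iio N)

/-- The ideal generated by the coefficients of `t, …, t ^ N` in the product of the generic
series. -/
noncomputable def jetTailIdeal [Fintype ι] (N : ℕ) : Ideal (MvPolynomial (ι × ℕ) k) :=
  Ideal.span ((fun m => jetCoeff ι k (m + 1)) '' Set.Iio N)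

variable {ι} in
/-- The substitution replacing the `i`-th generic series `f` by `t * f`. -/
noncomputable def jetShift [DecidableEq ι] (i : ι) :
    MvPolynomial (ι × ℕ) k →ₐ[k] MvPolynomial (ι × ℕ) k :=
  aeval fun p => if p.1 = i then p.2.casesOn 0 (fun j => X (i, j)) else X p

variable {ι k}

theorem coeff_zero_prod_jetSeries (s : Finset ι) :
    PowerSeries.coeff 0 (∏ l ∈ s, jetSeries k l) = ∏ l ∈ s, X (l, 0) := by
  rw [PowerSeries.coeff_zero_eq_constantCoeff_apply, map_prod]
  exact Finset.prod_congr rfl fun l _ => by simp [jetSeries]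

section Fintype

variable [Fintype ι]

theorem jetCoeff_zero : jetCoeff ι k 0 = ∏ l : ι, X (l, 0) :=
  coeff_zero_prod_jetSeries _

theorem jetCoeff_mem_jetIdeal {m N : ℕ} (h : m < N) : jetCoeff ι k m ∈ jetIdeal ι k N :=
  Ideal.subset_span ⟨m, h, rfl⟩

theorem jetIdeal_zero : jetIdeal ι k 0 = ⊥ := by
  rw [jetIdeal, Ideal.span_eq_bot]
  rintro _ ⟨m, hm, rfl⟩
  exact absurd hm (Nat.not_lt_zero m)

theorem jetIdeal_succ (N : ℕ) :
    jetIdeal ι k (N + 1) = Ideal.span {∏ l : ι, X (l, 0)} ⊔ jetTailIdeal ι k N := by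
  rw [jetIdeal, jetTailIdeal, ← Ideal.span_union, ← jetCoeff_zero]
  congr 1
  ext q
  constructor
  · rintro ⟨_ | m, hm, rfl⟩
    · exact Or.inl rfl
    · exact Or.inr ⟨m, Nat.lt_of_succ_lt_succ hm, rfl⟩
  · rintro (rfl | ⟨m, hm, rfl⟩)
    · exact ⟨0, Nat.succ_pos N, rfl⟩
    · exact ⟨m + 1, Nat.succ_lt_succ hm, rfl⟩

theorem jetTailIdeal_succ (N : ℕ) :
    jetTailIdeal ι k (N + 1) = Ideal.span {jetCoeff ι k (N + 1)} ⊔ jetTailIdeal ι k N := by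
  rw [jetTailIdeal, jetTailIdeal, ← Ideal.span_union]
  congr 1
  ext q
  constructor
  · rintro ⟨m, hm, rfl⟩
    rcases (Nat.lt_succ_iff_lt_or_eq.mp hm) with h | rfl
    · exact Or.inr ⟨m, h, rfl⟩
    · exact Or.inl rfl
  · rintro (rfl | ⟨m, hm, rfl⟩)
    · exact ⟨N, Nat.lt_succ_self N, rfl⟩
    · exact ⟨m, Nat.lt_succ_of_lt hm, rfl⟩

end Fintype

variable [DecidableEq ι]

@[simp] theorem jetShift_X_zero (i : ι) : jetShift k i (X (i, 0)) = 0 := by simp [jetShift]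

@[simp] theorem jetShift_X_succ (i : ι) (j : ℕ) :
    jetShift k i (X (i, j + 1)) = X (i, j) := by simp [jetShift]

theorem jetShift_X_of_ne {i l : ι} (hl : l ≠ i) (j : ℕ) :
    jetShift k i (X (l, j)) = X (l, j) := by simp [jetShift, hl]

theorem map_jetShift_jetSeries_self (i : ι) :
    PowerSeries.map (jetShift k i : _ →+* _) (jetSeries k i) = PowerSeries.X * jetSeries k i := by
  ext1 m
  cases m with
  | zero => simp [jetSeries, PowerSeries.coeff_map]
  | succ m => simp [jetSeries, PowerSeries.coeff_map, PowerSeries.coeff_succ_X_mul]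

theorem map_jetShift_jetSeries_of_ne {i l : ι} (hl : l ≠ i) :
    PowerSeries.map (jetShift k i : _ →+* _) (jetSeries k l) = jetSeries k l := by
  ext1 m
  simp [jetSeries, PowerSeries.coeff_map, jetShift_X_of_ne hl]

theorem map_jetShift_prod_of_notMem {i : ι} {s : Finset ι} (hi : i ∉ s) :
    PowerSeries.map (jetShift k i : _ →+* _) (∏ l ∈ s, jetSeries k l) =
      ∏ l ∈ s, jetSeries k l := by
  rw [map_prod]
  exact Finset.prod_congr rfl fun l hl =>
    map_jetShift_jetSeries_of_ne fun h => hi (h ▸ hl)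

theorem map_jetShift_prod_of_mem {i : ι} {s : Finset ι} (hi : i ∈ s) :
    PowerSeries.map (jetShift k i : _ →+* _) (∏ l ∈ s, jetSeries k l) =
      PowerSeries.X * ∏ l ∈ s, jetSeries k l := by
  rw [← Finset.mul_prod_erase s _ hi, map_mul, map_jetShift_jetSeries_self,
    map_jetShift_prod_of_notMem (Finset.notMem_erase i s), mul_assoc]

theorem jetShift_coeff (i : ι) (F : PowerSeries (MvPolynomial (ι × ℕ) k)) (m : ℕ) :
    jetShift k i (PowerSeries.coeff m F) =
      PowerSeries.coeff m (PowerSeries.map (jetShift k i : _ →+* _) F) := by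
  simp [PowerSeries.coeff_map]

theorem jetShift_rename (i : ι) (x : MvPolynomial (ι × ℕ) k) :
    jetShift k i (rename (fun p => if p.1 = i then (i, p.2 + 1) else p) x) = x := by
  suffices (jetShift k i).comp (rename fun p => if p.1 = i then (i, p.2 + 1) else p) =
      AlgHom.id k _ from DFunLike.congr_fun this x
  ext1 ⟨l, j⟩
  by_cases h : l = i
  · subst h; simp
  · simp [h, jetShift_X_of_ne]

theorem jetShift_surjective (i : ι) : Function.Surjective (jetShift k i) :=
  fun x => ⟨_, jetShift_rename i x⟩

theorem X_dvd_of_jetShift_eq_zero {i : ι} {x : MvPolynomial (ι × ℕ) k}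
    (hx : jetShift k i x = 0) : X (i, 0) ∣ x := by
  have key : ((Ideal.Quotient.mkₐ k (Ideal.span {X (i, 0)})).comp
      (rename fun p => if p.1 = i then (i, p.2 + 1) else p)).comp (jetShift k i) =
      Ideal.Quotient.mkₐ k (Ideal.span {(X (i, 0) : MvPolynomial (ι × ℕ) k)}) := by
    ext1 ⟨l, j⟩
    by_cases h : l = i
    · subst h
      cases j with
      | zero => simp
      | succ j => simp
    · simp [h, jetShift_X_of_ne]
  have h := DFunLike.congr_fun key x
  rw [AlgHom.comp_apply, hx, map_zero] at h
  exact Ideal.mem_span_singleton.mp (Ideal.Quotient.eq_zero_iff_mem.mp h.symm)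

variable [Fintype ι]

theorem jetShift_jetCoeff_succ (i : ι) (m : ℕ) :
    jetShift k i (jetCoeff ι k (m + 1)) = jetCoeff ι k m := by
  rw [jetCoeff, jetShift_coeff, map_jetShift_prod_of_mem (Finset.mem_univ i),
    PowerSeries.coeff_succ_X_mul, jetCoeff]

theorem map_jetTailIdeal (i : ι) (N : ℕ) :
    (jetTailIdeal ι k N).map (jetShift k i) = jetIdeal ι k N := by
  rw [jetTailIdeal, jetIdeal, Ideal.map_span, ← Set.image_comp]
  simp only [Function.comp_def, jetShift_jetCoeff_succ]

theorem jetShift_mem_jetIdeal {i : ι} {N : ℕ} {x : MvPolynomial (ι × ℕ) k}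
    (hx : x ∈ jetTailIdeal ι k N) : jetShift k i x ∈ jetIdeal ι k N :=
  map_jetTailIdeal (k := k) i N ▸ Ideal.mem_map_of_mem _ hx

theorem jetShift_mem_jetIdeal_of_mem_sup {i : ι} {N : ℕ} {w x : MvPolynomial (ι × ℕ) k}
    (hw : jetShift k i w = 0) (hx : x ∈ Ideal.span {w} ⊔ jetTailIdeal ι k N) :
    jetShift k i x ∈ jetIdeal ι k N := by
  obtain ⟨a, b, hb, rfl⟩ := Ideal.mem_span_singleton_sup.mp hx
  simpa [hw] using jetShift_mem_jetIdeal hb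

theorem exists_eq_add_of_jetShift_mem {i : ι} {N : ℕ} {x : MvPolynomial (ι × ℕ) k}
    (hx : jetShift k i x ∈ jetIdeal ι k N) :
    ∃ x' ∈ jetTailIdeal ι k N, ∃ y, x = x' + X (i, 0) * y := by
  rw [← map_jetTailIdeal i, Ideal.mem_map_iff_of_surjective _ (jetShift_surjective i)] at hx
  obtain ⟨x', hx', h⟩ := hx
  obtain ⟨y, hy⟩ := X_dvd_of_jetShift_eq_zero (i := i) (x := x - x') (by rw [map_sub, h, sub_self])
  exact ⟨x', hx', y, by rw [← hy]; ring⟩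

theorem mem_of_X_mul_mem [IsDomain k] {i : ι} {w y : MvPolynomial (ι × ℕ) k} {N : ℕ}
    (hreg : ∀ m < N, ∀ x, jetCoeff ι k m * x ∈ jetIdeal ι k m → x ∈ jetIdeal ι k m)
    (hy : X (i, 0) * y ∈ Ideal.span {X (i, 0) * w} ⊔ jetTailIdeal ι k N) :
    y ∈ Ideal.span {w} ⊔ jetTailIdeal ι k N := by
  induction N generalizing y with
  | zero =>
    obtain ⟨a, b, hb, h⟩ := Ideal.mem_span_singleton_sup.mp hy
    obtain rfl : b = 0 := by simpa [jetTailIdeal] using hb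
    refine Ideal.mem_span_singleton_sup.mpr ⟨a, 0, zero_mem _, ?_⟩
    refine mul_left_cancel₀ (X_ne_zero (i, 0)) ?_
    rw [← h]; ring
  | succ N ih =>
    rw [jetTailIdeal_succ] at hy ⊢
    obtain ⟨a, b, hb, h⟩ := Ideal.mem_span_singleton_sup.mp hy
    obtain ⟨v, b', hb', rfl⟩ := Ideal.mem_span_singleton_sup.mp hb
    clear hb
    have hv : jetShift k i v ∈ jetIdeal ι k N := by
      apply hreg N N.lt_succ_self
      have h' := congrArg (jetShift k i) h
      simp only [map_add, map_mul, jetShift_X_zero, zero_mul, mul_zero, zero_add,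
        jetShift_jetCoeff_succ] at h'
      rw [mul_comm, eq_neg_of_add_eq_zero_left h']
      exact neg_mem (jetShift_mem_jetIdeal hb')
    obtain ⟨v', hv', u, rfl⟩ := exists_eq_add_of_jetShift_mem hv
    have hu : y - jetCoeff ι k (N + 1) * u ∈ Ideal.span {w} ⊔ jetTailIdeal ι k N := by
      refine ih (fun m hm => hreg m (hm.trans N.lt_succ_self)) ?_
      refine Ideal.mem_span_singleton_sup.mpr ⟨a, jetCoeff ι k (N + 1) * v' + b',
        add_mem (Ideal.mul_mem_left _ _ hv') hb', ?_⟩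
      rw [mul_sub, ← h]; ring
    obtain ⟨a', e, he, h'⟩ := Ideal.mem_span_singleton_sup.mp hu
    refine Ideal.mem_span_singleton_sup.mpr ⟨a', u * jetCoeff ι k (N + 1) + e,
      Ideal.mem_span_singleton_sup.mpr ⟨u, e, he, rfl⟩, ?_⟩
    linear_combination h'

/-- `JetGeneric N B` says that `B` is not contained in any of the prime ideals generated by the
variables `X (i, j)` with `j < m i`, where `∑ i, m i = N`. -/
def JetGeneric : ℕ → Set (MvPolynomial (ι × ℕ) k) → Prop
  | 0, B => ∃ u ∈ B, u ≠ 0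
  | N + 1, B => ∀ i : ι, JetGeneric N (jetShift k i '' B)

theorem jetGeneric_jetCoeff [IsDomain k] (N : ℕ) : JetGeneric N {jetCoeff ι k N} := by
  induction N with
  | zero =>
    exact ⟨_, rfl, by rw [jetCoeff_zero]; exact Finset.prod_ne_zero_iff.mpr fun l _ => X_ne_zero _⟩
  | succ N ih => intro i; rwa [Set.image_singleton, jetShift_jetCoeff_succ]

theorem mem_sup_of_jetGeneric [IsDomain k] {N : ℕ} {B : Set (MvPolynomial (ι × ℕ) k)}
    (hreg : ∀ m < N, ∀ x, jetCoeff ι k m * x ∈ jetIdeal ι k m → x ∈ jetIdeal ι k m)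
    (hB : ∀ (i : ι) (x : MvPolynomial (ι × ℕ) k),
      (∀ u ∈ B, jetShift k i u * x ∈ jetIdeal ι k N) → x ∈ jetIdeal ι k N)
    (s : Finset ι) {x : MvPolynomial (ι × ℕ) k}
    (hx : ∀ u ∈ B, u * x ∈ Ideal.span {∏ l ∈ s, X (l, 0)} ⊔ jetTailIdeal ι k N) :
    x ∈ Ideal.span {∏ l ∈ s, X (l, 0)} ⊔ jetTailIdeal ι k N := by
  induction s using Finset.induction_on generalizing x with
  | empty => simp
  | insert i s hi ih =>
    rw [Finset.prod_insert hi] at hx ⊢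
    obtain ⟨x', hx', y, rfl⟩ := exists_eq_add_of_jetShift_mem <| hB i _ fun u hu => by
      rw [← map_mul]
      exact jetShift_mem_jetIdeal_of_mem_sup (by simp) (hx u hu)
    have hy : y ∈ Ideal.span {∏ l ∈ s, X (l, 0)} ⊔ jetTailIdeal ι k N := by
      refine ih fun u hu => mem_of_X_mul_mem (i := i) hreg ?_
      have h := sub_mem (hx u hu) (Ideal.mul_mem_left _ u (Ideal.mem_sup_right hx'))
      rwa [show u * (x' + X (i, 0) * y) - u * x' = X (i, 0) * (u * y) by ring] at h
    obtain ⟨a, b, hb, rfl⟩ := Ideal.mem_span_singleton_sup.mp hy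
    refine Ideal.mem_span_singleton_sup.mpr ⟨a, x' + X (i, 0) * b,
      add_mem hx' (Ideal.mul_mem_left _ _ hb), by ring⟩

/-- The jet ideal has no embedded components: it is closed under division by any set of
polynomials not contained in any of its minimal primes. -/
theorem mem_jetIdeal_of_jetGeneric [IsDomain k] {N : ℕ} {B : Set (MvPolynomial (ι × ℕ) k)}
    (hB : JetGeneric N B) {x : MvPolynomial (ι × ℕ) k} (hx : ∀ u ∈ B, u * x ∈ jetIdeal ι k N) :
    x ∈ jetIdeal ι k N := by
  induction N using Nat.strong_induction_on generalizing B x with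
  | _ N ih =>
    cases N with
    | zero =>
      obtain ⟨u, hu, hu0⟩ := hB
      have h := hx u hu
      rw [jetIdeal_zero, Ideal.mem_bot] at h ⊢
      exact (mul_eq_zero.mp h).resolve_left hu0
    | succ N =>
      simp only [jetIdeal_succ] at hx ⊢
      refine mem_sup_of_jetGeneric (fun m hm x hx => ?_) (fun i x hx => ?_) _ hx
      · exact ih m (hm.trans N.lt_succ_self) (jetGeneric_jetCoeff m) (by simpa using hx)
      · exact ih N N.lt_succ_self (hB i) (by simpa using hx)

end JetIdeal

theorem MvPolynomial.IsWeightedHomogeneous.aeval_of_addMonoidHom {k σ τ M M' : Type*} [CommRing k]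
    [AddCommMonoid M] [AddCommMonoid M'] {w : σ → M} {w' : τ → M'} (L : M →+ M')
    {g : σ → MvPolynomial τ k} (hg : ∀ s, IsWeightedHomogeneous w' (g s) (L (w s)))
    {x : MvPolynomial σ k} {m : M} (hx : IsWeightedHomogeneous w x m) :
    IsWeightedHomogeneous w' (aeval g x) (L m) := by
  rw [aeval_def, eval₂_eq]
  refine IsWeightedHomogeneous.sum _ _ _ fun d hd => ?_
  rw [← hx (mem_support_iff.mp hd), Finsupp.weight_apply, Finsupp.sum, map_sum,
    algebraMap_eq]
  refine IsWeightedHomogeneous.C_mul (IsWeightedHomogeneous.prod _ _ _ fun s _ => ?_) _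
  rw [map_nsmul]
  exact (hg s).pow _

section TwoSeries

variable {k : Type*} [CommRing k]

/-- The grading of the coefficients of two generic series by the degrees in both series and the
total order. -/
def pairWeight (p : Fin 2 × ℕ) : ℤ × ℤ × ℤ :=
  (if p.1 = 0 then 1 else 0, if p.1 = 0 then 0 else 1, p.2)

theorem isWeightedHomogeneous_jetCoeff (m : ℕ) :
    IsWeightedHomogeneous pairWeight (jetCoeff (Fin 2) k m) (1, 1, (m : ℤ)) := by
  rw [jetCoeff, Fin.prod_univ_two, PowerSeries.coeff_mul]
  refine IsWeightedHomogeneous.sum _ _ _ fun p hp => ?_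
  have h := (isWeightedHomogeneous_X k pairWeight ((0 : Fin 2), p.1)).mul
    (isWeightedHomogeneous_X k pairWeight ((1 : Fin 2), p.2))
  simp only [jetSeries, PowerSeries.coeff_mk]
  convert h using 1
  simp [pairWeight, ← Finset.HasAntidiagonal.mem_antidiagonal.mp hp]

theorem isWeightedHomogeneous_jetShift_zero {x : MvPolynomial (Fin 2 × ℕ) k} {D E W : ℤ}
    (hx : IsWeightedHomogeneous pairWeight x (D, E, W)) :
    IsWeightedHomogeneous pairWeight (jetShift k 0 x) (D, E, W - D) := by
  let L : ℤ × ℤ × ℤ →+ ℤ × ℤ × ℤ :=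
    { toFun := fun v => (v.1, v.2.1, v.2.2 - v.1)
      map_zero' := by simp
      map_add' := fun u v => by ext <;> simp; ring }
  refine hx.aeval_of_addMonoidHom L fun p => ?_
  obtain ⟨i, j⟩ := p
  obtain rfl | rfl : i = 0 ∨ i = 1 := by lia
  · cases j with
    | zero => exact isWeightedHomogeneous_zero _ _ _
    | succ j =>
      convert isWeightedHomogeneous_X k pairWeight ((0 : Fin 2), j) using 1 <;> simp [L, pairWeight]
  · convert isWeightedHomogeneous_X k pairWeight ((1 : Fin 2), j) using 1 <;> simp [L, pairWeight]

theorem isWeightedHomogeneous_jetShift_one {x : MvPolynomial (Fin 2 × ℕ) k} {D E W : ℤ}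
    (hx : IsWeightedHomogeneous pairWeight x (D, E, W)) :
    IsWeightedHomogeneous pairWeight (jetShift k 1 x) (D, E, W - E) := by
  let L : ℤ × ℤ × ℤ →+ ℤ × ℤ × ℤ :=
    { toFun := fun v => (v.1, v.2.1, v.2.2 - v.2.1)
      map_zero' := by simp
      map_add' := fun u v => by ext <;> simp; ring }
  refine hx.aeval_of_addMonoidHom L fun p => ?_
  obtain ⟨i, j⟩ := p
  obtain rfl | rfl : i = 0 ∨ i = 1 := by lia
  · convert isWeightedHomogeneous_X k pairWeight ((0 : Fin 2), j) using 1 <;> simp [L, pairWeight]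
  · cases j with
    | zero => exact isWeightedHomogeneous_zero _ _ _
    | succ j =>
      convert isWeightedHomogeneous_X k pairWeight ((1 : Fin 2), j) using 1 <;> simp [L, pairWeight]

theorem weightedHomogeneousComponent_mem_jetTailIdeal {N : ℕ} {x : MvPolynomial (Fin 2 × ℕ) k}
    (hx : x ∈ jetTailIdeal (Fin 2) k N) (v : ℤ × ℤ × ℤ) :
    weightedHomogeneousComponent pairWeight v x ∈ jetTailIdeal (Fin 2) k N := by
  let _ := weightedGradedAlgebra k pairWeight
  refine weightedHomogeneousComponent_mem_of_mem k pairWeight (Ideal.homogeneous_span _ _ ?_) hx v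
  rintro _ ⟨m, -, rfl⟩
  exact ⟨_, isWeightedHomogeneous_jetCoeff (m + 1)⟩

theorem weightedHomogeneousComponent_X_mul {σ M : Type*} [AddCommGroup M] (w : σ → M) (s : σ)
    (v : M) (x : MvPolynomial σ k) :
    weightedHomogeneousComponent w v (X s * x) =
      X s * weightedHomogeneousComponent w (v - w s) x := by
  classical
  induction x using MvPolynomial.induction_on' with
  | monomial d a =>
    have hd := isWeightedHomogeneous_monomial w d a rfl
    rw [weightedHomogeneousComponent_of_mem hd,
      weightedHomogeneousComponent_of_mem ((isWeightedHomogeneous_X k w s).mul hd)]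
    simp only [sub_eq_iff_eq_add, add_comm (w s), mul_ite, mul_zero]
  | add p q hp hq => rw [mul_add, map_add, hp, hq, map_add, mul_add]

theorem mem_jetIdeal_of_isWeightedHomogeneous (N : ℕ) {x : MvPolynomial (Fin 2 × ℕ) k}
    {D E W : ℤ} (hx : IsWeightedHomogeneous pairWeight x (D, E, W))
    (hW : ∀ m m' : ℕ, m + m' = N → W < D * m + E * m' - m * m') :
    x ∈ jetIdeal (Fin 2) k N := by
  induction N generalizing x D E W with
  | zero =>
    have hx0 : x = 0 := by
      by_contra h0
      obtain ⟨d, hd⟩ := exists_coeff_ne_zero h0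
      have h1 := congrArg (fun v => v.2.2) (hx hd)
      have h2 := hW 0 0 rfl
      have h3 : 0 ≤ (Finsupp.weight pairWeight d).2.2 := by
        rw [Finsupp.weight_apply, Finsupp.sum, Prod.snd_sum, Prod.snd_sum]
        exact Finset.sum_nonneg fun p _ => by simp [pairWeight]; positivity
      simp at h1 h2
      omega
    rw [hx0]; exact zero_mem _
  | succ N ih =>
    obtain ⟨x', hx', y, hy⟩ := exists_eq_add_of_jetShift_mem
      (ih (isWeightedHomogeneous_jetShift_zero hx) fun m m' h => by
        have := hW (m + 1) m' (by omega)
        push_cast at this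
        nlinarith)
    have hxc := congrArg (weightedHomogeneousComponent pairWeight (D, E, W)) hy
    rw [hx.weightedHomogeneousComponent_same, map_add, weightedHomogeneousComponent_X_mul] at hxc
    have hyc := weightedHomogeneousComponent_isWeightedHomogeneous (w := pairWeight)
      ((D, E, W) - pairWeight (0, 0)) y
    have hv : (D, E, W) - pairWeight (0, 0) = (D - 1, E, W) := by simp [pairWeight]
    rw [hv] at hyc hxc
    obtain ⟨y', hy', z, hz⟩ := exists_eq_add_of_jetShift_mem
      (ih (isWeightedHomogeneous_jetShift_one hyc) fun m m' h => by
        have := hW m (m' + 1) (by omega)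
        push_cast at this
        nlinarith)
    rw [jetIdeal_succ, Fin.prod_univ_two, hxc, hz]
    refine Ideal.mem_span_singleton_sup.mpr ⟨z, _, add_mem
      (weightedHomogeneousComponent_mem_jetTailIdeal hx' (D, E, W))
      (Ideal.mul_mem_left _ (X (0, 0)) hy'), ?_⟩
    ring

theorem X_pow_mul_X_pow_mem_jetIdeal {p q j : ℕ} (hj : j ≤ q) :
    (X (0, p) : MvPolynomial (Fin 2 × ℕ) k) ^ ((p + 1) * q + 1) * X (1, j) ^ (p * (q + 1) + 1) ∈
      jetIdeal (Fin 2) k (p + q + 1) := by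
  have h := ((isWeightedHomogeneous_X k pairWeight ((0 : Fin 2), p)).pow ((p + 1) * q + 1)).mul
    ((isWeightedHomogeneous_X k pairWeight ((1 : Fin 2), j)).pow (p * (q + 1) + 1))
  have hv : ((p + 1) * q + 1) • pairWeight (0, p) + (p * (q + 1) + 1) • pairWeight (1, j) =
      (((p : ℤ) + 1) * q + 1, (p : ℤ) * (q + 1) + 1,
        (((p : ℤ) + 1) * q + 1) * p + ((p : ℤ) * (q + 1) + 1) * j) := by
    simp [pairWeight]
  rw [hv] at h
  refine mem_jetIdeal_of_isWeightedHomogeneous _ h fun m m' hm => ?_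
  obtain ⟨κ, hκ⟩ : ∃ κ : ℤ, (m : ℤ) = p + 1 + κ := ⟨m - p - 1, by ring⟩
  have hm' : (m : ℤ) + m' = p + q + 1 := by exact_mod_cast hm
  have hκ' : (m' : ℤ) = q - κ := by linarith
  have hjq : ((p : ℤ) * (q + 1) + 1) * j ≤ ((p : ℤ) * (q + 1) + 1) * q :=
    mul_le_mul_of_nonneg_left (by exact_mod_cast hj) (by positivity)
  rw [hκ, hκ']
  nlinarith [sq_nonneg κ, sq_nonneg (κ + 1)]

/-- If the coefficients of `F * G` up to order `p + q` lie in an ideal, then so does a product of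
powers of the coefficients of `F` and `G` of order `p` and at most `q`. -/
theorem coeff_pow_mul_coeff_pow_mem {A : Type*} [CommRing A] {I : Ideal A} {F G : PowerSeries A}
    {p q j : ℕ} (hI : ∀ m < p + q + 1, PowerSeries.coeff m (F * G) ∈ I) (hj : j ≤ q) :
    PowerSeries.coeff p F ^ ((p + 1) * q + 1) * PowerSeries.coeff j G ^ (p * (q + 1) + 1) ∈ I := by
  let φ : MvPolynomial (Fin 2 × ℕ) ℤ →ₐ[ℤ] A :=
    aeval fun p => PowerSeries.coeff p.2 (if p.1 = 0 then F else G)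
  have hle : jetIdeal (Fin 2) ℤ (p + q + 1) ≤ I.comap φ := by
    refine Ideal.span_le.mpr ?_
    rintro _ ⟨m, hm, rfl⟩
    have : φ (jetCoeff (Fin 2) ℤ m) = PowerSeries.coeff m (F * G) := by
      simp [jetCoeff, PowerSeries.coeff_mul, jetSeries, φ]
    rw [SetLike.mem_coe, Ideal.mem_comap, this]
    exact hI m hm
  have h := hle (X_pow_mul_X_pow_mem_jetIdeal (p := p) hj)
  simpa [φ] using h

end TwoSeries

section MonomialPow

variable {ι k : Type*} [Fintype ι] [DecidableEq ι] [CommRing k]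

/-- The complementary products `∏ l ≠ i, f l` of the generic series have powers of coefficients,
of order less than `N - h i`, outside all minimal primes of the jet ideal. -/
theorem jetGeneric_coeff_erase [IsDomain k] (e : ι → ℕ) (N : ℕ) (h : ι → ℤ) (hN : ∑ i, h i < N)
    (B : Set (MvPolynomial (ι × ℕ) k))
    (hB : ∀ (i : ι) (m : ℕ), m + h i < N →
      PowerSeries.coeff m (∏ l ∈ Finset.univ.erase i, jetSeries k l) ^ e i ∈ B) :
    JetGeneric N B := by
  induction N generalizing h B with
  | zero =>
    obtain ⟨i, -, hi⟩ := Finset.exists_lt_of_sum_lt (s := Finset.univ) (f := h) (g := fun _ => 0)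
      (by simpa using hN)
    refine ⟨_, hB i 0 (by simpa using hi), pow_ne_zero _ ?_⟩
    rw [coeff_zero_prod_jetSeries]
    exact Finset.prod_ne_zero_iff.mpr fun l _ => X_ne_zero _
  | succ N ih =>
    intro j
    refine ih (fun i => h i - if i = j then 1 else 0) ?_ _ fun i m hm => ?_
    · rw [Finset.sum_sub_distrib, Finset.sum_ite_eq' Finset.univ j, if_pos (Finset.mem_univ j)]
      push_cast at hN
      linarith
    · by_cases hij : i = j
      · subst hij
        refine ⟨_, hB i m (by rw [if_pos rfl] at hm; push_cast; linarith), ?_⟩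
        rw [map_pow, jetShift_coeff, map_jetShift_prod_of_notMem (Finset.notMem_erase i _)]
      · refine ⟨_, hB i (m + 1) (by rw [if_neg hij] at hm; push_cast; linarith), ?_⟩
        rw [map_pow, jetShift_coeff, map_jetShift_prod_of_mem
          (Finset.mem_erase.mpr ⟨Ne.symm hij, Finset.mem_univ j⟩), PowerSeries.coeff_succ_X_mul]

theorem prod_X_pow_mem_jetIdeal [IsDomain k] (h : ι → ℕ) {d : ℕ}
    (hd : ∀ i, (h i + 1) * (∑ j, h j - h i) + 1 ≤ d) :
    (∏ i, (X (i, h i) : MvPolynomial (ι × ℕ) k)) ^ d ∈ jetIdeal ι k (∑ i, h i + 1) := by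
  have key (i : ι) (m : ℕ) (hm : m + h i < ∑ j, h j + 1) :
      (X (i, h i) : MvPolynomial (ι × ℕ) k) ^ ((h i + 1) * (∑ j, h j - h i) + 1) *
        PowerSeries.coeff m (∏ l ∈ Finset.univ.erase i, jetSeries k l) ^
          (h i * (∑ j, h j - h i + 1) + 1) ∈ jetIdeal ι k (∑ i, h i + 1) := by
    have hle : h i ≤ ∑ j, h j := Finset.single_le_sum_of_canonicallyOrdered (Finset.mem_univ i)
    have hX : PowerSeries.coeff (h i) (jetSeries k i) = X (i, h i) := by simp [jetSeries]
    rw [← hX]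
    refine coeff_pow_mul_coeff_pow_mem (fun m hm => ?_) (by omega)
    rw [Finset.mul_prod_erase _ _ (Finset.mem_univ i)]
    exact jetCoeff_mem_jetIdeal (by omega)
  obtain ⟨e, he⟩ : ∃ e : ι → ℕ, ∀ i, e i = h i * (∑ j, h j - h i + 1) + 1 := ⟨_, fun _ => rfl⟩
  obtain ⟨δ, hδ⟩ : ∃ δ : ι → ℕ, ∀ i, δ i = (h i + 1) * (∑ j, h j - h i) + 1 := ⟨_, fun _ => rfl⟩
  simp only [← he, ← hδ] at key hd
  refine mem_jetIdeal_of_jetGeneric (jetGeneric_coeff_erase e _ (fun i => h i)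
    (by push_cast; linarith) {u | ∃ (i : ι) (m : ℕ), m + h i < ∑ j, h j + 1 ∧
      u = PowerSeries.coeff m (∏ l ∈ Finset.univ.erase i, jetSeries k l) ^ e i}
    fun i m hm => ⟨i, m, by exact_mod_cast hm, rfl⟩) ?_
  rintro _ ⟨i, m, hm, rfl⟩
  obtain ⟨r, hr⟩ : X (i, h i) ^ δ i ∣ (∏ l, (X (l, h l) : MvPolynomial (ι × ℕ) k)) ^ d :=
    (pow_dvd_pow _ (hd i)).trans <| pow_dvd_pow_of_dvd
      (Finset.dvd_prod_of_mem (fun l => X (l, h l)) (Finset.mem_univ i)) d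
  rw [hr, mul_left_comm, ← mul_assoc]
  exact Ideal.mul_mem_right _ _ (key i m hm)

end MonomialPow

section Derivation

variable {k A : Type*} [CommRing k] [CommRing A] [Algebra k A] (D : Derivation k A A)

/-- If a derivation of the coefficient ring acts on two power series as `d / dt`, it acts so on
their product. -/
theorem derivation_coeff_mul {F G : PowerSeries A}
    (hF : ∀ m, D (PowerSeries.coeff m F) = PowerSeries.coeff (m + 1) F * (m + 1))
    (hG : ∀ m, D (PowerSeries.coeff m G) = PowerSeries.coeff (m + 1) G * (m + 1)) (m : ℕ) :
    D (PowerSeries.coeff m (F * G)) = PowerSeries.coeff (m + 1) (F * G) * (m + 1) := by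
  simp only [← PowerSeries.coeff_derivative] at hF hG ⊢
  rw [Derivation.leibniz, map_add, smul_eq_mul, smul_eq_mul, mul_comm G, PowerSeries.coeff_mul,
    PowerSeries.coeff_mul, PowerSeries.coeff_mul, map_sum, ← Finset.sum_add_distrib]
  refine Finset.sum_congr rfl fun p _ => ?_
  rw [Derivation.leibniz, hF, hG, smul_eq_mul, smul_eq_mul]
  ring

theorem derivation_coeff_prod {ι : Type*} (s : Finset ι) (F : ι → PowerSeries A)
    (hF : ∀ i ∈ s, ∀ m,
      D (PowerSeries.coeff m (F i)) = PowerSeries.coeff (m + 1) (F i) * (m + 1)) (m : ℕ) :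
    D (PowerSeries.coeff m (∏ i ∈ s, F i)) =
      PowerSeries.coeff (m + 1) (∏ i ∈ s, F i) * (m + 1) := by
  classical
  induction s using Finset.induction_on generalizing m with
  | empty =>
    rw [Finset.prod_empty, PowerSeries.coeff_one, PowerSeries.coeff_one]
    split_ifs <;> simp_all
  | insert i s hi ih =>
    rw [Finset.prod_insert hi]
    exact derivation_coeff_mul D (hF i (Finset.mem_insert_self i s))
      (ih fun j hj => hF j (Finset.mem_insert_of_mem hj)) m

theorem derivation_iterate_coeff_zero {F : PowerSeries A}
    (hF : ∀ m, D (PowerSeries.coeff m F) = PowerSeries.coeff (m + 1) F * (m + 1)) (m : ℕ) :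
    (⇑D)^[m] (PowerSeries.coeff 0 F) = m.factorial * PowerSeries.coeff m F := by
  induction m with
  | zero => simp
  | succ m ih =>
    rw [Function.iterate_succ_apply', ih, Derivation.leibniz, Derivation.map_natCast, hF,
      Nat.factorial_succ]
    push_cast
    simp only [smul_eq_mul, mul_zero, add_zero]
    ring

end Derivation

/-- The substitution dividing the `j`-th derivative of each variable by `j!`, which turns the
coefficients of the generic series into Taylor coefficients. -/
noncomputable def taylorSubst (ι K : Type*) [Field K] :
    MvPolynomial (ι × ℕ) K →ₐ[K] MvPolynomial (ι × ℕ) K :=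
  aeval fun p => C ((p.2.factorial : K)⁻¹) * X p

theorem derivation_iterate_prod_X {ι K : Type*} [Fintype ι] [Field K] [CharZero K] (m : ℕ) :
    (⇑(mkDerivation K fun p : ι × ℕ => (X (p.1, p.2 + 1) : MvPolynomial (ι × ℕ) K)))^[m]
      (∏ i, X (i, 0)) = m.factorial * taylorSubst ι K (jetCoeff ι K m) := by
  set D := mkDerivation K fun p : ι × ℕ => (X (p.1, p.2 + 1) : MvPolynomial (ι × ℕ) K)
  let F : ι → PowerSeries (MvPolynomial (ι × ℕ) K) := fun i =>
    PowerSeries.map (taylorSubst ι K : _ →+* _) (jetSeries K i)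
  have hcoeff (i : ι) (m : ℕ) :
      PowerSeries.coeff m (F i) = C ((m.factorial : K)⁻¹) * X (i, m) := by
    simp [F, PowerSeries.coeff_map, jetSeries, taylorSubst]
  have hF (i : ι) (m : ℕ) :
      D (PowerSeries.coeff m (F i)) = PowerSeries.coeff (m + 1) (F i) * (m + 1) := by
    have hm : ((m.factorial : K)⁻¹) = (((m + 1).factorial : K)⁻¹) * (m + 1) := by
      rw [Nat.factorial_succ]
      push_cast
      field_simp
    rw [hcoeff, hcoeff, ← smul_eq_C_mul, Derivation.map_smul, mkDerivation_X, smul_eq_C_mul, hm]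
    simp only [map_mul, map_add, map_natCast, map_one]
    ring
  have h := derivation_iterate_coeff_zero D
    (fun m => derivation_coeff_prod D Finset.univ F (fun i _ => hF i) m) m
  have h0 : PowerSeries.coeff 0 (∏ i, F i) = ∏ i, X (i, 0) := by
    rw [PowerSeries.coeff_zero_eq_constantCoeff_apply, map_prod]
    refine Finset.prod_congr rfl fun i _ => ?_
    rw [← PowerSeries.coeff_zero_eq_constantCoeff_apply, hcoeff]
    simp
  rw [← h0, h, ← map_prod, PowerSeries.coeff_map, jetCoeff]
  rfl

/-- In `K{y_1,…,y_n} = K[y_i^{(j)}]` (variables indexed by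
`Fin n × ℕ`) with the derivation `D` determined by `D(y_i^{(j)}) = y_i^{(j+1)}`, and
`I_H` the ideal generated by `D^k(y_1⋯y_n)` for `0 ≤ k ≤ H` where `H = h_1 + ⋯ + h_n`:
for `d = max_i (h_i+1)(H-h_i) + 1` one has `(y_1^{(h_1)} ⋯ y_n^{(h_n)})^d ∈ I_H`. -/
theorem monomial_pow_mem_jet_ideal
    (K : Type*) [Field K] [CharZero K] (n : ℕ) (hn : 0 < n) (h : Fin n → ℕ)
    (D : Derivation K (MvPolynomial (Fin n × ℕ) K) (MvPolynomial (Fin n × ℕ) K))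
    (hD : D = MvPolynomial.mkDerivation K (fun p : Fin n × ℕ => X (p.1, p.2 + 1)))
    (d : ℕ) (hd : d = (Finset.univ.sup fun i => (h i + 1) * (∑ j, h j - h i)) + 1) :
    (∏ i, (X (i, h i) : MvPolynomial (Fin n × ℕ) K)) ^ d ∈
      Ideal.span {q : MvPolynomial (Fin n × ℕ) K |
        ∃ k ≤ ∑ i, h i, q = (⇑D)^[k] (∏ i, X (i, 0))} := by
  set I := Ideal.span {q : MvPolynomial (Fin n × ℕ) K |
    ∃ k ≤ ∑ i, h i, q = (⇑D)^[k] (∏ i, X (i, 0))} with hI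
  have hmem {a : K} (ha : a ≠ 0) {x : MvPolynomial (Fin n × ℕ) K} (hx : C a * x ∈ I) : x ∈ I := by
    have h' := I.mul_mem_left (C a⁻¹) hx
    rwa [← mul_assoc, ← C_mul, inv_mul_cancel₀ ha, C_1, one_mul] at h'
  have hle : jetIdeal (Fin n) K (∑ i, h i + 1) ≤ I.comap (taylorSubst (Fin n) K) := by
    refine Ideal.span_le.mpr ?_
    rintro _ ⟨m, hm, rfl⟩
    refine hmem (a := m.factorial) (by exact_mod_cast m.factorial_ne_zero) ?_
    rw [map_natCast, ← derivation_iterate_prod_X, ← hD]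
    exact Ideal.subset_span ⟨m, Nat.lt_succ_iff.mp hm, rfl⟩
  have hpow := hle <| prod_X_pow_mem_jetIdeal (k := K) h (d := d) fun i => by
    rw [hd]
    exact Nat.succ_le_succ
      (Finset.le_sup (f := fun i => (h i + 1) * (∑ j, h j - h i)) (Finset.mem_univ i))
  refine hmem (a := (∏ i, ((h i).factorial : K)⁻¹) ^ d) ?_ ?_
  · exact pow_ne_zero _ (Finset.prod_ne_zero_iff.mpr fun i _ =>
      inv_ne_zero (by exact_mod_cast (h i).factorial_ne_zero))
  · rw [Ideal.mem_comap, map_pow, map_prod] at hpow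
    rw [map_pow, map_prod, ← mul_pow, ← Finset.prod_mul_distrib]
    simpa only [taylorSubst, aeval_X] using hpow
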